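/- Let Ω be a bounded domain in ℂ^n and φ_j a decreasing sequence of plurisubharmonic weight functions on Ω converging to φ. Let z be a fixed point of Ω, and let K_j and K be the Bergman kernels of Ω for the weights φ_j and φ respectively. Then K_j(z,z) decreases to K(z,z). -/

import Mathlib

open MeasureTheory Filter Set Metric Complex
open scoped ENNReal NNReal Topology

noncomputable section

namespace Berndtsson

instance (n : ℕ) : MeasurableSpace (EuclideanSpace ℂ (Fin n)) := borel _
instance (n : ℕ) : BorelSpace (EuclideanSpace ℂ (Fin n)) := ⟨rfl⟩
instance (n : ℕ) : MeasureSpace (EuclideanSpace ℂ (Fin n)) :=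
  ⟨Measure.map (EuclideanSpace.equiv (Fin n) ℂ).symm volume⟩

abbrev Cn (n : ℕ) := EuclideanSpace ℂ (Fin n)

/-- A function `f`, with values in `EReal`, is plurisubharmonic on `s` if it is upper
semicontinuous on `s` and satisfies the sub-mean value inequality on every complex circle
whose corresponding closed disk is contained in `s` (formulated via continuous majorants,
which for upper semicontinuous integrands is equivalent to the upper-integral form). -/
def PlurisubharmonicOn {E : Type*} [NormedAddCommGroup E] [NormedSpace ℂ E]
    (f : E → EReal) (s : Set E) : Prop :=
  UpperSemicontinuousOn f s ∧
    ∀ z ∈ s, ∀ w : E, ∀ r : ℝ, 0 < r →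
      (∀ l : ℂ, ‖l‖ ≤ r → z + l • w ∈ s) →
      ∀ h : ℝ → ℝ, Continuous h →
        (∀ θ : ℝ, f (z + ((r : ℂ) * Complex.exp (θ * Complex.I)) • w) ≤ (h θ : EReal)) →
        f z ≤ (((2 * Real.pi)⁻¹ * ∫ θ in (0:ℝ)..(2 * Real.pi), h θ : ℝ) : EReal)

/-- Plurisubharmonicity for real-valued functions. -/
def PshOn {E : Type*} [NormedAddCommGroup E] [NormedSpace ℂ E] (f : E → ℝ) (s : Set E) : Prop :=
  PlurisubharmonicOn (fun z => (f z : EReal)) s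

/-- A pseudoconvex domain: an open set admitting a plurisubharmonic exhaustion function. -/
def Pseudoconvex {E : Type*} [NormedAddCommGroup E] [NormedSpace ℂ E] (D : Set E) : Prop :=
  IsOpen D ∧ ∃ u : E → ℝ, PshOn u D ∧ ∀ c : ℝ, IsCompact {z ∈ D | u z ≤ c}

/-- `log` with values in `EReal`, sending nonpositive reals to `⊥`. -/
def elog (x : ℝ) : EReal := if 0 < x then ((Real.log x : ℝ) : EReal) else ⊥

/-- Membership in the weighted Bergman space `A²(Ω, e^{-φ})`. -/
def MemA2 {n : ℕ} (Ω : Set (Cn n)) (φ : Cn n → ℝ) (h : Cn n → ℂ) : Prop :=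
  DifferentiableOn ℂ h Ω ∧
    IntegrableOn (fun ζ => ‖h ζ‖ ^ 2 * Real.exp (-φ ζ)) Ω volume

/-- `Kz` is the Bergman kernel of `A²(Ω, e^{-φ})` at the point `z`:
it belongs to the space and reproduces the value at `z` of every member. -/
def IsBergmanKernelAt {n : ℕ} (Ω : Set (Cn n)) (φ : Cn n → ℝ) (z : Cn n)
    (Kz : Cn n → ℂ) : Prop :=
  MemA2 Ω φ Kz ∧
    ∀ h : Cn n → ℂ, MemA2 Ω φ h →
      ∫ ζ in Ω, h ζ * (starRingEnd ℂ) (Kz ζ) * (Real.exp (-φ ζ) : ℂ) = h z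

/-- The Bergman kernel on the diagonal, via its extremal characterization
`K(z,z) = sup {|h(z)|² : h holomorphic on Ω, ∫_Ω |h|² e^{-φ} ≤ 1}`. -/
def bergmanDiag {n : ℕ} (Ω : Set (Cn n)) (φ : Cn n → ℝ) (z : Cn n) : ℝ :=
  sSup {v : ℝ | ∃ h : Cn n → ℂ, DifferentiableOn ℂ h Ω ∧
    IntegrableOn (fun ζ => ‖h ζ‖ ^ 2 * Real.exp (-φ ζ)) Ω volume ∧
    (∫ ζ in Ω, ‖h ζ‖ ^ 2 * Real.exp (-φ ζ)) ≤ 1 ∧ v = ‖h z‖ ^ 2}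

end Berndtsson

namespace Berndtsson

section Holomorphic

variable {E : Type*} [NormedAddCommGroup E] [NormedSpace ℂ E]

/-- The disk of radius `R` in direction `w` around `x` is contained in a closed ball. -/
lemma add_smul_mem_closedBall {x w : E} {R r : ℝ} (hRr : R * ‖w‖ ≤ r) {l : ℂ} (hl : ‖l‖ ≤ R) :
    x + l • w ∈ closedBall x r := by
  rw [mem_closedBall, dist_eq_norm, add_sub_cancel_left, norm_smul]
  exact (mul_le_mul_of_nonneg_right hl (norm_nonneg w)).trans hRr

/-- Restriction of a holomorphic function to a complex line. -/
lemma diffContOnCl_comp_line {f : E → ℂ} {x w : E} {R r : ℝ}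
    (hf : ∀ y ∈ closedBall x r, DifferentiableAt ℂ f y) (hRr : R * ‖w‖ ≤ r) :
    DiffContOnCl ℂ (fun l : ℂ => f (x + l • w)) (ball 0 R) := by
  have h : DifferentiableOn ℂ (fun l : ℂ => f (x + l • w)) (closedBall 0 R) := fun l hl =>
    ((hf _ (add_smul_mem_closedBall hRr (mem_closedBall_zero_iff.1 hl))).comp l
      (by fun_prop)).differentiableWithinAt
  exact h.diffContOnCl_ball le_rfl

/-- Cauchy estimate for the Fréchet derivative of a holomorphic function. -/
lemma norm_fderiv_le_of_closedBall {f : E → ℂ} {x : E} {r C : ℝ} (hr : 0 < r) (hC : 0 ≤ C)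
    (hf : ∀ y ∈ closedBall x r, DifferentiableAt ℂ f y) (hb : ∀ y ∈ closedBall x r, ‖f y‖ ≤ C) :
    ‖fderiv ℂ f x‖ ≤ C / r := by
  refine ContinuousLinearMap.opNorm_le_bound _ (by positivity) fun w => ?_
  rcases eq_or_ne w 0 with rfl | hw
  · simp
  have hw' : 0 < ‖w‖ := norm_pos_iff.2 hw
  have hRr : r / ‖w‖ * ‖w‖ ≤ r := (div_mul_cancel₀ r hw'.ne').le
  have hd : HasDerivAt (fun l : ℂ => f (x + l • w)) (fderiv ℂ f x w) 0 := by
    have h1 : HasDerivAt (fun l : ℂ => x + l • w) w 0 := by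
      simpa using ((hasDerivAt_id (0 : ℂ)).smul_const w).const_add x
    have h2 : HasFDerivAt f (fderiv ℂ f x) (x + (0 : ℂ) • w) := by
      simpa using (hf x (mem_closedBall_self hr.le)).hasFDerivAt
    exact h2.comp_hasDerivAt 0 h1
  have := norm_deriv_le_of_forall_mem_sphere_norm_le (div_pos hr hw')
    (diffContOnCl_comp_line hf hRr) fun l hl =>
      hb _ (add_smul_mem_closedBall hRr (mem_sphere_zero_iff_norm.1 hl).le)
  rw [hd.deriv] at this
  calc ‖fderiv ℂ f x w‖ ≤ C / (r / ‖w‖) := this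
    _ = C / r * ‖w‖ := by field_simp

/-- The pointwise limit of a locally uniformly Cauchy sequence of holomorphic functions on an open
subset of a complex normed space is holomorphic. -/
lemma differentiableOn_of_uniformCauchySeqOn {F : ℕ → E → ℂ} {g : E → ℂ} {U : Set E}
    (hU : IsOpen U) (hF : ∀ n, DifferentiableOn ℂ (F n) U)
    (hcau : ∀ x ∈ U, ∃ V ∈ 𝓝 x, UniformCauchySeqOn F atTop V)
    (hg : ∀ x ∈ U, Tendsto (fun n => F n x) atTop (𝓝 (g x))) : DifferentiableOn ℂ g U := by
  intro x₀ hx₀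
  obtain ⟨V, hV, hcV⟩ := hcau x₀ hx₀
  obtain ⟨ρ, hρ, hsub⟩ := Metric.nhds_basis_closedBall.mem_iff.1 (inter_mem (hU.mem_nhds hx₀) hV)
  have hdiff : ∀ n, ∀ y ∈ closedBall x₀ ρ, DifferentiableAt ℂ (F n) y := fun n y hy =>
    (hF n).differentiableAt (hU.mem_nhds (hsub hy).1)
  have hball : ∀ x ∈ ball x₀ (ρ / 2), closedBall x (ρ / 2) ⊆ closedBall x₀ ρ := fun x hx =>
    closedBall_subset_closedBall' (by linarith [mem_ball.1 hx])
  have hcd : UniformCauchySeqOn (fun n x => fderiv ℂ (F n) x) atTop (ball x₀ (ρ / 2)) := by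
    rw [Metric.uniformCauchySeqOn_iff] at hcV ⊢
    intro ε hε
    obtain ⟨N, hN⟩ := hcV (ε * (ρ / 2) / 2) (by positivity)
    refine ⟨N, fun m hm n hn x hx => ?_⟩
    have hx' := hball x hx
    have hxm := mem_closedBall_self (x := x) (half_pos hρ).le
    rw [dist_eq_norm, ← fderiv_fun_sub (hdiff m x (hx' hxm)) (hdiff n x (hx' hxm))]
    refine (norm_fderiv_le_of_closedBall (C := ε * (ρ / 2) / 2) (half_pos hρ) (by positivity)
      (fun y hy => (hdiff m y (hx' hy)).sub (hdiff n y (hx' hy))) fun y hy => ?_).trans_lt ?_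
    · rw [Pi.sub_apply, ← dist_eq_norm]
      exact (hN m hm n hn y (hsub (hx' hy)).2).le
    · rw [mul_div_right_comm, mul_div_cancel_right₀ _ (by positivity)]
      linarith
  have hlim : ∀ x ∈ ball x₀ (ρ / 2), ∃ L, Tendsto (fun n => fderiv ℂ (F n) x) atTop (𝓝 L) :=
    fun x hx => cauchySeq_tendsto_of_complete (hcd.cauchySeq hx)
  choose! g' hg' using hlim
  exact (hasFDerivAt_of_tendstoUniformlyOn isOpen_ball (hcd.tendstoUniformlyOn_of_tendsto hg')
    (fun n x hx => (hdiff n x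
      (hball x hx (mem_closedBall_self (half_pos hρ).le))).hasFDerivAt)
    (fun x hx => hg x (hsub (hball x hx (mem_closedBall_self (half_pos hρ).le))).1)
    (mem_ball_self (half_pos hρ))).differentiableAt.differentiableWithinAt

/-- Sub-mean value inequality for the square of the modulus of a holomorphic function. -/
lemma enorm_sq_le_lintegral_circle {f : E → ℂ} {x w : E} {r : ℝ}
    (hf : ∀ y ∈ closedBall x r, DifferentiableAt ℂ f y) (hw : ‖w‖ ≤ r) :
    ENNReal.ofReal (2 * Real.pi) * ‖f x‖ₑ ^ 2 ≤
      ∫⁻ θ in Ioc 0 (2 * Real.pi), ‖f (x + Complex.exp (θ * I) • w)‖ₑ ^ 2 := by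
  have h := (diffContOnCl_comp_line (R := |(1 : ℝ)|) (fun y hy => (hf y hy).pow 2)
    (by simpa using hw)).circleAverage
  rw [Real.circleAverage_def, intervalIntegral.integral_of_le Real.two_pi_pos.le] at h
  have h2 : (∫ θ in Ioc 0 (2 * Real.pi), f (x + Complex.exp (θ * I) • w) ^ 2) =
      (2 * Real.pi) • f x ^ 2 := by
    rw [← inv_smul_eq_iff₀ Real.two_pi_pos.ne']
    simpa [circleMap] using h
  calc _ = ‖(2 * Real.pi) • f x ^ 2‖ₑ := by
        rw [enorm_smul, enorm_pow, Real.enorm_of_nonneg Real.two_pi_pos.le]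
    _ ≤ _ := by
        rw [← h2]
        simp_rw [← enorm_pow]
        exact enorm_integral_le_lintegral_enorm _

end Holomorphic

section Volume

variable {n : ℕ}

instance : (volume : Measure (Cn n)).IsAddHaarMeasure :=
  inferInstanceAs (Measure.map (EuclideanSpace.equiv (Fin n) ℂ).symm volume).IsAddHaarMeasure

/-- Multiplication by a unimodular scalar preserves the volume. -/
lemma measurePreserving_smul {a : ℂ} (ha : ‖a‖ = 1) :
    MeasurePreserving (fun w : Cn n => a • w) volume volume := by
  have hmeas : Measurable fun w : Cn n => a • w := (continuous_const_smul a).measurable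
  have ha0 : a ≠ 0 := by rintro rfl; simp at ha
  have : (Measure.map (fun w : Cn n => a • w) volume).IsAddHaarMeasure :=
    (ContinuousLinearEquiv.smulLeft (Units.mk0 a ha0) :
      Cn n ≃L[ℂ] Cn n).isAddHaarMeasure_map volume
  have h := Measure.isAddLeftInvariant_eq_smul (Measure.map (fun w : Cn n => a • w) volume) volume
  set c := Measure.addHaarScalarFactor (Measure.map (fun w : Cn n => a • w) volume) volume
  have hpre : (fun w : Cn n => a • w) ⁻¹' ball 0 1 = ball 0 1 := by
    ext w
    simp [norm_smul, ha]
  have hb : (c : ℝ≥0∞) * volume (ball (0 : Cn n) 1) = 1 * volume (ball (0 : Cn n) 1) := by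
    have := congrArg (fun μ => μ (ball (0 : Cn n) 1)) h
    simp only [Measure.smul_apply] at this
    rw [Measure.map_apply hmeas measurableSet_ball, hpre] at this
    rw [one_mul]
    exact this.symm
  rw [ENNReal.mul_left_inj (measure_ball_pos _ _ one_pos).ne' measure_ball_lt_top.ne] at hb
  refine ⟨hmeas, h.trans ?_⟩
  rw [ENNReal.coe_eq_one.1 hb, one_smul]

/-- Sub-mean value inequality over balls for the square of the modulus of a holomorphic function. -/
lemma enorm_sq_mul_volume_ball_le {f : Cn n → ℂ} {x : Cn n} {r : ℝ}
    (hf : ∀ y ∈ closedBall x r, DifferentiableAt ℂ f y) :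
    ‖f x‖ₑ ^ 2 * volume (ball (0 : Cn n) r) ≤ ∫⁻ y in ball x r, ‖f y‖ₑ ^ 2 := by
  set F : Cn n → ℝ≥0∞ := (ball x r).indicator fun y => ‖f y‖ₑ ^ 2 with hF
  have hFm : Measurable F := by
    classical
    have hc : ContinuousOn (fun y => ‖f y‖ₑ ^ 2) (ball x r) := fun y hy =>
      ((ENNReal.continuous_pow 2).continuousAt.comp
        (hf y (ball_subset_closedBall hy)).continuousAt.enorm).continuousWithinAt
    rw [hF, ← piecewise_eq_indicator]
    exact hc.measurable_piecewise continuousOn_const measurableSet_ball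
  have hcirc : ∀ θ : ℝ, ‖Complex.exp (θ * I)‖ = 1 := norm_exp_ofReal_mul_I
  have hjoint : Measurable fun p : Cn n × ℝ => F (x + Complex.exp (p.2 * I) • p.1) :=
    hFm.comp (by fun_prop : Continuous fun p : Cn n × ℝ =>
      x + Complex.exp (p.2 * I) • p.1).measurable
  have hpi : ENNReal.ofReal (2 * Real.pi) ≠ 0 := by simp [Real.pi_pos]
  rw [← ENNReal.mul_le_mul_iff_right hpi ENNReal.ofReal_ne_top]
  calc ENNReal.ofReal (2 * Real.pi) * (‖f x‖ₑ ^ 2 * volume (ball (0 : Cn n) r))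
      = ∫⁻ _ in ball (0 : Cn n) r, ENNReal.ofReal (2 * Real.pi) * ‖f x‖ₑ ^ 2 := by
        rw [setLIntegral_const, mul_assoc]
    _ ≤ ∫⁻ w in ball (0 : Cn n) r, ∫⁻ θ in Ioc 0 (2 * Real.pi),
          F (x + Complex.exp (θ * I) • w) := by
        refine setLIntegral_mono' measurableSet_ball fun w hw => ?_
        refine (enorm_sq_le_lintegral_circle hf (mem_ball_zero_iff.1 hw).le).trans_eq ?_
        refine lintegral_congr fun θ => ?_
        rw [hF, indicator_of_mem]
        rw [mem_ball, dist_eq_norm, add_sub_cancel_left, norm_smul, hcirc, one_mul]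
        exact mem_ball_zero_iff.1 hw
    _ ≤ ∫⁻ w : Cn n, ∫⁻ θ in Ioc 0 (2 * Real.pi), F (x + Complex.exp (θ * I) • w) :=
        setLIntegral_le_lintegral _ _
    _ = ∫⁻ θ in Ioc 0 (2 * Real.pi), ∫⁻ w : Cn n, F (x + Complex.exp (θ * I) • w) :=
        lintegral_lintegral_swap hjoint.aemeasurable
    _ = ∫⁻ _ in Ioc 0 (2 * Real.pi), ∫⁻ y, F y := by
        refine lintegral_congr fun θ => ?_
        exact ((measurePreserving_add_left volume x).comp
          (measurePreserving_smul (hcirc θ))).lintegral_comp hFm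
    _ = ENNReal.ofReal (2 * Real.pi) * ∫⁻ y in ball x r, ‖f y‖ₑ ^ 2 := by
        rw [setLIntegral_const, Real.volume_Ioc, sub_zero, mul_comm, hF,
          lintegral_indicator measurableSet_ball]

end Volume
section Bergman

variable {n : ℕ} {Ω : Set (Cn n)} {φ ψ : Cn n → ℝ} {f g : Cn n → ℂ} {z : Cn n}

/-- The squared norm of `A²(Ω, e^{-φ})`. -/
def normSqA2 (Ω : Set (Cn n)) (φ : Cn n → ℝ) (f : Cn n → ℂ) : ℝ :=
  ∫ ζ in Ω, ‖f ζ‖ ^ 2 * Real.exp (-φ ζ)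

/-- The values whose supremum is `bergmanDiag`. -/
def bergmanValues (Ω : Set (Cn n)) (φ : Cn n → ℝ) (z : Cn n) : Set ℝ :=
  {v | ∃ h : Cn n → ℂ, MemA2 Ω φ h ∧ normSqA2 Ω φ h ≤ 1 ∧ v = ‖h z‖ ^ 2}

lemma bergmanDiag_eq : bergmanDiag Ω φ z = sSup (bergmanValues Ω φ z) := by
  simp only [bergmanDiag, bergmanValues, MemA2, normSqA2, and_assoc]

lemma PshOn.aemeasurable (hφ : PshOn φ Ω) (hΩ : IsOpen Ω) :
    AEMeasurable φ (volume.restrict Ω) := by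
  have h := upperSemicontinuousOn_iff_restrict.2 hφ.1
  have h' : AEMeasurable (fun x => (φ x : EReal)) (volume.restrict Ω) :=
    aemeasurable_restrict_of_measurable_subtype hΩ.measurableSet h.measurable
  simpa using h'.ereal_toReal

lemma aestronglyMeasurable_norm_sq_mul_exp (hΩ : IsOpen Ω)
    (hφ : AEMeasurable φ (volume.restrict Ω)) (hf : DifferentiableOn ℂ f Ω) :
    AEStronglyMeasurable (fun ζ => ‖f ζ‖ ^ 2 * Real.exp (-φ ζ)) (volume.restrict Ω) :=
  ((hf.continuousOn.norm.pow 2).aestronglyMeasurable hΩ.measurableSet).mul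
    (Real.measurable_exp.comp_aemeasurable hφ.neg).aestronglyMeasurable

lemma normSqA2_nonneg : 0 ≤ normSqA2 Ω φ f :=
  integral_nonneg fun _ => by positivity

lemma MemA2.zero : MemA2 Ω φ 0 := by
  refine ⟨differentiableOn_const 0, ?_⟩
  simp

lemma normSqA2_zero : normSqA2 Ω φ 0 = 0 := by simp [normSqA2]

lemma MemA2.const_mul (hf : MemA2 Ω φ f) (c : ℂ) : MemA2 Ω φ fun ζ => c * f ζ := by
  refine ⟨hf.1.const_mul c, ?_⟩
  simpa only [norm_mul, mul_pow, mul_assoc, IntegrableOn] using hf.2.const_mul (‖c‖ ^ 2)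

lemma normSqA2_const_mul (c : ℂ) :
    normSqA2 Ω φ (fun ζ => c * f ζ) = ‖c‖ ^ 2 * normSqA2 Ω φ f := by
  simp only [normSqA2, norm_mul, mul_pow, mul_assoc, integral_const_mul]

lemma MemA2.add (hf : MemA2 Ω φ f) (hg : MemA2 Ω φ g) (hΩ : IsOpen Ω)
    (hφ : AEMeasurable φ (volume.restrict Ω)) : MemA2 Ω φ (f + g) := by
  refine ⟨hf.1.add hg.1, ((hf.2.const_mul 2).add (hg.2.const_mul 2)).mono'
    (aestronglyMeasurable_norm_sq_mul_exp hΩ hφ (hf.1.add hg.1)) (ae_of_all _ fun ζ => ?_)⟩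
  have h : ‖f ζ + g ζ‖ ^ 2 ≤ 2 * ‖f ζ‖ ^ 2 + 2 * ‖g ζ‖ ^ 2 := by
    nlinarith [norm_add_le (f ζ) (g ζ), norm_nonneg (f ζ + g ζ), sq_nonneg (‖f ζ‖ - ‖g ζ‖)]
  rw [Real.norm_of_nonneg (by positivity)]
  calc _ ≤ (2 * ‖f ζ‖ ^ 2 + 2 * ‖g ζ‖ ^ 2) * Real.exp (-φ ζ) :=
        mul_le_mul_of_nonneg_right h (Real.exp_pos _).le
    _ = _ := by simp only [Pi.add_apply]; ring

lemma MemA2.sub (hf : MemA2 Ω φ f) (hg : MemA2 Ω φ g) (hΩ : IsOpen Ω)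
    (hφ : AEMeasurable φ (volume.restrict Ω)) : MemA2 Ω φ (f - g) := by
  convert hf.add (hg.const_mul (-1)) hΩ hφ using 1
  ext ζ
  simp [sub_eq_add_neg]

lemma normSqA2_parallelogram (hf : MemA2 Ω φ f) (hg : MemA2 Ω φ g) (hΩ : IsOpen Ω)
    (hφ : AEMeasurable φ (volume.restrict Ω)) :
    normSqA2 Ω φ (f + g) + normSqA2 Ω φ (f - g) = 2 * normSqA2 Ω φ f + 2 * normSqA2 Ω φ g := by
  simp only [normSqA2]
  rw [← integral_add (hf.add hg hΩ hφ).2 (hf.sub hg hΩ hφ).2, ← integral_const_mul,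
    ← integral_const_mul, ← integral_add (hf.2.const_mul 2) (hg.2.const_mul 2)]
  congr 1
  ext ζ
  have := parallelogram_law_with_norm ℝ (f ζ) (g ζ)
  simp only [Pi.add_apply, Pi.sub_apply]
  linear_combination Real.exp (-φ ζ) * this

/-- Larger weight functions give larger spaces. -/
lemma MemA2.mono (hf : MemA2 Ω φ f) (hΩ : IsOpen Ω) (hψ : AEMeasurable ψ (volume.restrict Ω))
    (hle : ∀ ζ ∈ Ω, φ ζ ≤ ψ ζ) : MemA2 Ω ψ f := by
  refine ⟨hf.1, hf.2.mono' (aestronglyMeasurable_norm_sq_mul_exp hΩ hψ hf.1)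
    ((ae_restrict_mem hΩ.measurableSet).mono fun ζ hζ => ?_)⟩
  rw [Real.norm_of_nonneg (by positivity)]
  have := hle ζ hζ
  gcongr

lemma normSqA2_mono (hf : MemA2 Ω φ f) (hΩ : IsOpen Ω) (hψ : AEMeasurable ψ (volume.restrict Ω))
    (hle : ∀ ζ ∈ Ω, φ ζ ≤ ψ ζ) : normSqA2 Ω ψ f ≤ normSqA2 Ω φ f :=
  setIntegral_mono_on (hf.mono hΩ hψ hle).2 hf.2 hΩ.measurableSet fun ζ hζ => by
    have := hle ζ hζ
    gcongr

/-- Point evaluations are locally uniformly bounded on `A²(Ω, e^{-φ})`. -/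
lemma exists_norm_sq_le_mul_normSqA2 (hΩ : IsOpen Ω) (hφ : PshOn φ Ω) {x₀ : Cn n} (hx₀ : x₀ ∈ Ω) :
    ∃ V ∈ 𝓝 x₀, ∃ C : ℝ, 0 ≤ C ∧ ∀ f, MemA2 Ω φ f → ∀ x ∈ V, ‖f x‖ ^ 2 ≤ C * normSqA2 Ω φ f := by
  have husc : ∀ᶠ y in 𝓝 x₀, φ y < φ x₀ + 1 := by
    have h := hφ.1 x₀ hx₀ ((φ x₀ + 1 : ℝ) : EReal) (EReal.coe_lt_coe (by linarith))
    rw [hΩ.nhdsWithin_eq hx₀] at h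
    exact h.mono fun y hy => EReal.coe_lt_coe_iff.1 hy
  set M := φ x₀ + 1
  obtain ⟨ρ, hρ, hsub⟩ := Metric.nhds_basis_closedBall.mem_iff.1 (inter_mem (hΩ.mem_nhds hx₀) husc)
  set v := volume (ball (0 : Cn n) (ρ / 2)) with hv
  have hv0 : v ≠ 0 := (measure_ball_pos _ _ (half_pos hρ)).ne'
  have hvt : v ≠ ∞ := measure_ball_lt_top.ne
  refine ⟨ball x₀ (ρ / 2), ball_mem_nhds _ (half_pos hρ), Real.exp M / v.toReal, by positivity,
    fun f hf x hx => ?_⟩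
  have hball : closedBall x (ρ / 2) ⊆ closedBall x₀ ρ :=
    closedBall_subset_closedBall' (by linarith [mem_ball.1 hx])
  have h1 := enorm_sq_mul_volume_ball_le (f := f) (x := x) (r := ρ / 2) fun y hy =>
    hf.1.differentiableAt (hΩ.mem_nhds (hsub (hball hy)).1)
  have h2 : ∫⁻ y in ball x (ρ / 2), ‖f y‖ₑ ^ 2 ≤
      ENNReal.ofReal (Real.exp M * normSqA2 Ω φ f) := by
    rw [ENNReal.ofReal_mul (Real.exp_pos _).le, normSqA2,
      ofReal_integral_eq_lintegral_ofReal hf.2 (ae_of_all _ fun _ => by positivity),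
      ← lintegral_const_mul' _ _ ENNReal.ofReal_ne_top]
    refine (setLIntegral_mono' measurableSet_ball fun y hy => ?_).trans
      (lintegral_mono_set fun y hy => (hsub (hball (ball_subset_closedBall hy))).1)
    have hy' : φ y < M := (hsub (hball (ball_subset_closedBall hy))).2
    rw [← ENNReal.ofReal_mul (Real.exp_pos _).le, ← ofReal_norm,
      ← ENNReal.ofReal_pow (norm_nonneg _)]
    refine ENNReal.ofReal_le_ofReal ?_
    have : 1 ≤ Real.exp M * Real.exp (-φ y) := by
      rw [← Real.exp_add]
      exact Real.one_le_exp (by linarith)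
    nlinarith [sq_nonneg ‖f y‖]
  have h3 := h1.trans h2
  rw [← hv, ← ENNReal.ofReal_toReal hvt, ← ofReal_norm,
    ← ENNReal.ofReal_pow (norm_nonneg _), ← ENNReal.ofReal_mul (by positivity),
    ENNReal.ofReal_le_ofReal_iff (mul_nonneg (Real.exp_pos _).le normSqA2_nonneg)] at h3
  rw [div_mul_eq_mul_div, le_div_iff₀ (ENNReal.toReal_pos hv0 hvt)]
  exact h3

lemma bergmanValues_nonempty : (bergmanValues Ω φ z).Nonempty :=
  ⟨_, 0, MemA2.zero, normSqA2_zero.trans_le zero_le_one, rfl⟩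

lemma bergmanDiag_nonneg : 0 ≤ bergmanDiag Ω φ z := by
  rw [bergmanDiag_eq]
  exact Real.sSup_nonneg fun v ⟨_, _, _, hv⟩ => hv ▸ sq_nonneg _

lemma bddAbove_bergmanValues (hΩ : IsOpen Ω) (hφ : PshOn φ Ω) (hz : z ∈ Ω) :
    BddAbove (bergmanValues Ω φ z) := by
  obtain ⟨V, hV, C, hC, h⟩ := exists_norm_sq_le_mul_normSqA2 hΩ hφ hz
  refine ⟨C, ?_⟩
  rintro _ ⟨f, hm, hn, rfl⟩
  exact (h f hm z (mem_of_mem_nhds hV)).trans (mul_le_of_le_one_right hC hn)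

/-- Larger weight functions admit more competitors. -/
lemma bergmanValues_subset (hΩ : IsOpen Ω) (hψ : AEMeasurable ψ (volume.restrict Ω))
    (hle : ∀ ζ ∈ Ω, φ ζ ≤ ψ ζ) : bergmanValues Ω φ z ⊆ bergmanValues Ω ψ z :=
  fun _ ⟨h, hm, hn, hv⟩ => ⟨h, hm.mono hΩ hψ hle, (normSqA2_mono hm hΩ hψ hle).trans hn, hv⟩

lemma norm_sq_le_bergmanDiag_mul (hb : BddAbove (bergmanValues Ω φ z)) (hf : MemA2 Ω φ f) :
    ‖f z‖ ^ 2 ≤ bergmanDiag Ω φ z * normSqA2 Ω φ f := by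
  have key : ∀ N : ℝ, normSqA2 Ω φ f < N → ‖f z‖ ^ 2 ≤ bergmanDiag Ω φ z * N := by
    intro N hN
    have hN0 : 0 < N := normSqA2_nonneg.trans_lt hN
    have hc : ‖((√N)⁻¹ : ℂ)‖ ^ 2 = N⁻¹ := by
      rw [norm_inv, Complex.norm_real, inv_pow, Real.norm_eq_abs, sq_abs, Real.sq_sqrt hN0.le]
    have hle : N⁻¹ * ‖f z‖ ^ 2 ≤ bergmanDiag Ω φ z := by
      rw [bergmanDiag_eq]
      refine le_csSup hb ⟨_, hf.const_mul ((√N)⁻¹ : ℂ), ?_, ?_⟩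
      · rw [normSqA2_const_mul, hc, inv_mul_le_one₀ hN0]
        exact hN.le
      · rw [norm_mul, mul_pow, hc]
    rwa [inv_mul_le_iff₀ hN0, mul_comm] at hle
  have hlim : Tendsto (fun N => bergmanDiag Ω φ z * N) (𝓝[>] normSqA2 Ω φ f)
      (𝓝 (bergmanDiag Ω φ z * normSqA2 Ω φ f)) :=
    ((continuous_const_mul _).tendsto _).mono_left nhdsWithin_le_nhds
  exact ge_of_tendsto hlim (eventually_mem_nhdsWithin.mono key)

/-- Competitors whose value at `z` is a nonnegative real number nearly realise the supremum. -/
lemma exists_memA2_lt_sq {c : ℝ} (hc : c < bergmanDiag Ω φ z) :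
    ∃ h, MemA2 Ω φ h ∧ normSqA2 Ω φ h ≤ 1 ∧ ∃ a : ℝ, 0 ≤ a ∧ h z = a ∧ c < a ^ 2 := by
  rw [bergmanDiag_eq] at hc
  obtain ⟨_, ⟨h, hm, hn, rfl⟩, hlt⟩ := exists_lt_of_lt_csSup bergmanValues_nonempty hc
  obtain ⟨u, hu, hz⟩ := Complex.exists_norm_eq_mul_self (h z)
  refine ⟨_, hm.const_mul u, ?_, ‖h z‖, norm_nonneg _, hz.symm, hlt⟩
  rwa [normSqA2_const_mul, hu, one_pow, one_mul]

/-- A sequence in `A²(Ω, e^{-φ})` that is Cauchy in norm converges pointwise on `Ω` to a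
holomorphic function. -/
lemma exists_differentiableOn_tendsto (hΩ : IsOpen Ω) (hφ : PshOn φ Ω) {h : ℕ → Cn n → ℂ}
    (hm : ∀ i, MemA2 Ω φ (h i)) {δ : ℕ → ℝ} (hδ : Tendsto δ atTop (𝓝 0))
    (hcau : ∀ i j, i ≤ j → normSqA2 Ω φ (h i - h j) ≤ δ i) :
    ∃ g : Cn n → ℂ, DifferentiableOn ℂ g Ω ∧
      ∀ x ∈ Ω, Tendsto (fun i => h i x) atTop (𝓝 (g x)) := by
  have hunif : ∀ x ∈ Ω, ∃ V ∈ 𝓝 x, UniformCauchySeqOn h atTop V := by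
    intro x hx
    obtain ⟨V, hV, C, hC, hb⟩ := exists_norm_sq_le_mul_normSqA2 hΩ hφ hx
    refine ⟨V, hV, Metric.uniformCauchySeqOn_iff.2 fun ε hε => ?_⟩
    have hlim : Tendsto (fun i => C * δ i) atTop (𝓝 0) := by simpa using hδ.const_mul C
    obtain ⟨N, hN⟩ := (hlim.eventually_lt_const (by positivity : 0 < (ε / 2) ^ 2)).exists
    have hclose : ∀ m ≥ N, ∀ y ∈ V, dist (h N y) (h m y) < ε / 2 := fun m hmN y hy => by
      rw [dist_eq_norm]
      refine lt_of_pow_lt_pow_left₀ 2 (by positivity) (lt_of_le_of_lt ?_ hN)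
      exact (hb _ ((hm N).sub (hm m) hΩ (hφ.aemeasurable hΩ)) y hy).trans
        (mul_le_mul_of_nonneg_left (hcau N m hmN) hC)
    refine ⟨N, fun m hmN k hkN y hy => ?_⟩
    linarith [hclose m hmN y hy, hclose k hkN y hy, dist_triangle_left (h m y) (h k y) (h N y)]
  have hlim : ∀ x ∈ Ω, ∃ w, Tendsto (fun i => h i x) atTop (𝓝 w) := fun x hx => by
    obtain ⟨V, hV, hc⟩ := hunif x hx
    exact cauchySeq_tendsto_of_complete (hc.cauchySeq (mem_of_mem_nhds hV))
  choose! g hg using hlim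
  exact ⟨g, differentiableOn_of_uniformCauchySeqOn hΩ (fun i => (hm i).1) hunif hg, hg⟩

/-- Fatou's lemma for a sequence of unit-ball members of varying weighted Bergman spaces. -/
lemma memA2_of_tendsto (hΩ : IsOpen Ω) {φs : ℕ → Cn n → ℝ} {h : ℕ → Cn n → ℂ}
    (hm : ∀ i, MemA2 Ω (φs i) (h i)) (hn : ∀ i, normSqA2 Ω (φs i) (h i) ≤ 1)
    (hφs : ∀ x ∈ Ω, Tendsto (fun i => φs i x) atTop (𝓝 (φ x)))
    (hg : DifferentiableOn ℂ g Ω) (hh : ∀ x ∈ Ω, Tendsto (fun i => h i x) atTop (𝓝 (g x))) :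
    MemA2 Ω φ g ∧ normSqA2 Ω φ g ≤ 1 := by
  have hlim : ∀ᵐ x ∂volume.restrict Ω, Tendsto (fun i => ‖h i x‖ ^ 2 * Real.exp (-φs i x)) atTop
      (𝓝 (‖g x‖ ^ 2 * Real.exp (-φ x))) :=
    (ae_restrict_mem hΩ.measurableSet).mono fun x hx =>
      ((hh x hx).norm.pow 2).mul ((Real.continuous_exp.tendsto _).comp (hφs x hx).neg)
  have hmeas := aestronglyMeasurable_of_tendsto_ae atTop
    (fun i => (hm i).2.aestronglyMeasurable) hlim
  have hnn : ∀ {ψ : Cn n → ℝ} {f : Cn n → ℂ},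
      0 ≤ᵐ[volume.restrict Ω] fun x => ‖f x‖ ^ 2 * Real.exp (-ψ x) :=
    ae_of_all _ fun _ => by positivity
  have hfatou : ∫⁻ x in Ω, ENNReal.ofReal (‖g x‖ ^ 2 * Real.exp (-φ x)) ≤ 1 := calc
    _ = ∫⁻ x in Ω, liminf (fun i => ENNReal.ofReal (‖h i x‖ ^ 2 * Real.exp (-φs i x))) atTop :=
      lintegral_congr_ae (hlim.mono fun x hx => (ENNReal.tendsto_ofReal hx).liminf_eq.symm)
    _ ≤ liminf (fun i => ∫⁻ x in Ω, ENNReal.ofReal (‖h i x‖ ^ 2 * Real.exp (-φs i x))) atTop :=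
      lintegral_liminf_le' fun i => (hm i).2.aestronglyMeasurable.aemeasurable.ennreal_ofReal
    _ ≤ liminf (fun _ : ℕ => (1 : ℝ≥0∞)) atTop := by
      refine liminf_le_liminf (Eventually.of_forall fun i => ?_)
      rw [← ofReal_integral_eq_lintegral_ofReal (hm i).2 hnn]
      exact ENNReal.ofReal_le_one.2 (hn i)
    _ = 1 := liminf_const 1
  refine ⟨⟨hg, hmeas, (hasFiniteIntegral_iff_ofReal hnn).2
    (hfatou.trans_lt ENNReal.one_lt_top)⟩, ?_⟩
  rw [normSqA2, integral_eq_lintegral_of_nonneg_ae hnn hmeas]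
  exact ENNReal.toReal_le_of_le_ofReal zero_le_one (by simpa using hfatou)

/-- If the Bergman kernels of a decreasing sequence of weights are bounded below by `L`, then so is
the Bergman kernel of the limit weight. -/
lemma exists_memA2_le_norm_sq (hΩ : IsOpen Ω) {φs : ℕ → Cn n → ℝ} (hpsh : ∀ j, PshOn (φs j) Ω)
    (hdec : ∀ x ∈ Ω, Antitone fun j => φs j x)
    (hlim : ∀ x ∈ Ω, Tendsto (fun j => φs j x) atTop (𝓝 (φ x))) (hz : z ∈ Ω) {L : ℝ} (hL : 0 < L)
    (hK : Tendsto (fun j => bergmanDiag Ω (φs j) z) atTop (𝓝 L))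
    (hLK : ∀ j, L ≤ bergmanDiag Ω (φs j) z) :
    ∃ g, MemA2 Ω φ g ∧ normSqA2 Ω φ g ≤ 1 ∧ L ≤ ‖g z‖ ^ 2 := by
  have hmeas : ∀ j, AEMeasurable (φs j) (volume.restrict Ω) := fun j => (hpsh j).aemeasurable hΩ
  obtain ⟨ε, hεanti, hε0, hε⟩ := exists_seq_strictAnti_tendsto (0 : ℝ)
  have hex := fun j => exists_memA2_lt_sq (Ω := Ω) (φ := φs j) (z := z) (c := L - ε j)
    (by linarith [hLK j, hε0 j])
  choose h hm hn a ha hza hlt using hex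
  have hm' : ∀ {i j}, i ≤ j → MemA2 Ω (φs i) (h j) := fun hij =>
    (hm _).mono hΩ (hmeas _) fun ζ hζ => hdec ζ hζ hij
  have hn' : ∀ {i j}, i ≤ j → normSqA2 Ω (φs i) (h j) ≤ 1 := fun hij =>
    (normSqA2_mono (hm _) hΩ (hmeas _) fun ζ hζ => hdec ζ hζ hij).trans (hn _)
  -- Midpoints of near-extremal functions are near-extremal, so the parallelogram law applies.
  have hcau : ∀ i j, i ≤ j → normSqA2 Ω (φs 0) (h i - h j) ≤
      4 - 4 * (L - ε i) / bergmanDiag Ω (φs i) z := by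
    intro i j hij
    have hsub := (hm i).sub (hm' hij) hΩ (hmeas i)
    have hadd := (hm i).add (hm' hij) hΩ (hmeas i)
    have h0 : normSqA2 Ω (φs 0) (h i - h j) ≤ normSqA2 Ω (φs i) (h i - h j) :=
      normSqA2_mono hsub hΩ (hmeas 0) fun ζ hζ => hdec ζ hζ (Nat.zero_le i)
    have hpar := normSqA2_parallelogram (hm i) (hm' hij) hΩ (hmeas i)
    have hval := norm_sq_le_bergmanDiag_mul (bddAbove_bergmanValues hΩ (hpsh i) hz) hadd
    rw [Pi.add_apply, hza, hza, ← Complex.ofReal_add, Complex.norm_real, Real.norm_eq_abs,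
      sq_abs] at hval
    have hεij := hεanti.antitone hij
    have hmid : 4 * (L - ε i) ≤ (a i + a j) ^ 2 := by
      rcases le_total (a i) (a j) with hle | hle
      · nlinarith [hlt i, ha i]
      · nlinarith [hlt j, ha j]
    have hdiv : 4 * (L - ε i) / bergmanDiag Ω (φs i) z ≤ normSqA2 Ω (φs i) (h i + h j) := by
      rw [div_le_iff₀' (hL.trans_le (hLK i))]
      exact hmid.trans hval
    linarith [hn i, hn' hij]
  have hδ : Tendsto (fun i => 4 - 4 * (L - ε i) / bergmanDiag Ω (φs i) z) atTop (𝓝 0) := by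
    have := (((hε.const_sub L).const_mul 4).div hK hL.ne').const_sub 4
    rwa [sub_zero, mul_div_cancel_right₀ _ hL.ne', sub_self] at this
  obtain ⟨g, hg, hhg⟩ := exists_differentiableOn_tendsto hΩ (hpsh 0)
    (fun i => hm' (Nat.zero_le i)) hδ hcau
  obtain ⟨hgm, hgn⟩ := memA2_of_tendsto hΩ hm hn hlim hg hhg
  refine ⟨g, hgm, hgn, ?_⟩
  have hleft : Tendsto (fun i => L - ε i) atTop (𝓝 L) := by simpa using hε.const_sub L
  refine le_of_tendsto_of_tendsto' hleft ((hhg z hz).norm.pow 2) fun i => ?_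
  rw [hza, Complex.norm_real, Real.norm_eq_abs, sq_abs]
  exact (hlt i).le

end Bergman

/-- **Lemma 4.3.**  Let `Ω` be a bounded domain and `φ_j` a decreasing sequence of
plurisubharmonic weight functions on `Ω` converging to `φ`.  For fixed `z ∈ Ω`, the Bergman
kernels satisfy: `K_j(z,z)` decreases to `K(z,z)`. -/
theorem bergman_kernels_decrease_weights (n : ℕ) (Ω : Set (Cn n))
    (hΩ : IsOpen Ω) (hΩconn : IsConnected Ω) (hΩbd : Bornology.IsBounded Ω)
    (φ : Cn n → ℝ) (φs : ℕ → Cn n → ℝ)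
    (hpsh : ∀ j, PshOn (φs j) Ω)
    (hdec : ∀ z ∈ Ω, Antitone fun j => φs j z)
    (hlim : ∀ z ∈ Ω, Tendsto (fun j => φs j z) atTop (nhds (φ z)))
    (z : Cn n) (hz : z ∈ Ω) :
    Antitone (fun j => bergmanDiag Ω (φs j) z) ∧
      Tendsto (fun j => bergmanDiag Ω (φs j) z) atTop (nhds (bergmanDiag Ω φ z)) := by
  have hmeas : ∀ j, AEMeasurable (φs j) (volume.restrict Ω) := fun j => (hpsh j).aemeasurable hΩ
  have hbdd : ∀ j, BddAbove (bergmanValues Ω (φs j) z) := fun j =>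
    bddAbove_bergmanValues hΩ (hpsh j) hz
  have hsub : ∀ j, bergmanValues Ω φ z ⊆ bergmanValues Ω (φs j) z := fun j =>
    bergmanValues_subset hΩ (hmeas j) fun ζ hζ => (hdec ζ hζ).le_of_tendsto (hlim ζ hζ) j
  have hanti : Antitone (fun j => bergmanDiag Ω (φs j) z) := fun i j hij => by
    simp only [bergmanDiag_eq]
    exact csSup_le_csSup (hbdd i) bergmanValues_nonempty
      (bergmanValues_subset hΩ (hmeas i) fun ζ hζ => hdec ζ hζ hij)
  have hle : ∀ j, bergmanDiag Ω φ z ≤ bergmanDiag Ω (φs j) z := fun j => by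
    simp only [bergmanDiag_eq]
    exact csSup_le_csSup (hbdd j) bergmanValues_nonempty (hsub j)
  refine ⟨hanti, ?_⟩
  have hbelow : BddBelow (range fun j => bergmanDiag Ω (φs j) z) :=
    ⟨_, forall_mem_range.2 hle⟩
  have hK := tendsto_atTop_ciInf hanti hbelow
  set L := ⨅ j, bergmanDiag Ω (φs j) z
  convert hK
  refine le_antisymm (le_ciInf hle) ?_
  rcases le_or_gt L 0 with hL | hL
  · exact hL.trans bergmanDiag_nonneg
  obtain ⟨g, hg, hgn, hgz⟩ := exists_memA2_le_norm_sq hΩ hpsh hdec hlim hz hL hK (ciInf_le hbelow)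
  rw [bergmanDiag_eq]
  exact hgz.trans (le_csSup ((hbdd 0).mono (hsub 0)) ⟨g, hg, hgn, rfl⟩)

end Berndtsson
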